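/- For every integer q ≥ 2, C(q−1, ⌊q/2⌋) ≤ √(2/π) · 2^{q−1} / √(q − 1/2). -/

import Mathlib

theorem le_of_sq_le_sq_aux {a b : ℝ} (h : a ^ 2 ≤ b ^ 2) (hb : 0 ≤ b) : a ≤ b :=
  le_of_abs_le (abs_le_of_sq_le_sq h hb)

theorem W_mul_centralBinom_sq (n : ℕ) :
    Real.Wallis.W n * ((n.centralBinom : ℝ) ^ 2 * (2 * n + 1)) = 16 ^ n := by
  induction n with
  | zero => simp [Real.Wallis.W]
  | succ k ih =>
    have h : ((k : ℝ) + 1) * ((k + 1).centralBinom : ℝ) = 2 * (2 * k + 1) * k.centralBinom := by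
      exact_mod_cast Nat.succ_mul_centralBinom_succ k
    have h' : ((k + 1).centralBinom : ℝ) = 2 * (2 * k + 1) * k.centralBinom / (k + 1) := by
      rw [← h]; field_simp
    rw [Real.Wallis.W_succ, h', pow_succ (16 : ℝ), ← ih]
    push_cast
    field_simp
    ring

theorem pi_le_W (n : ℕ) : Real.pi ≤ Real.Wallis.W n * ((2 * n + 1) / (n + 1 / 4)) := by
  have hanti : Antitone (fun n : ℕ => Real.Wallis.W n * ((2 * (n : ℝ) + 1) / (n + 1 / 4))) := by
    refine antitone_nat_of_succ_le fun k => ?_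
    rw [Real.Wallis.W_succ, mul_assoc]
    refine mul_le_mul_of_nonneg_left ?_ (Real.Wallis.W_pos k).le
    push_cast
    have hk : (0 : ℝ) ≤ k := k.cast_nonneg
    rw [div_mul_div_comm, div_mul_div_comm, div_le_div_iff₀ (by positivity) (by positivity)]
    have : 0 ≤ (2 * (k : ℝ) + 1) * (2 * k + 3) := by positivity
    nlinarith
  have hlim : Filter.Tendsto (fun n : ℕ => Real.Wallis.W n * ((2 * (n : ℝ) + 1) / (n + 1 / 4)))
      Filter.atTop (nhds Real.pi) := by
    have h1 : Filter.Tendsto (fun n : ℕ => (n : ℝ) + 1 / 4) Filter.atTop Filter.atTop :=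
      Filter.tendsto_atTop_add_const_right _ _ tendsto_natCast_atTop_atTop
    have h2 : Filter.Tendsto (fun n : ℕ => (2 : ℝ) + 1 / 2 * ((n : ℝ) + 1 / 4)⁻¹)
        Filter.atTop (nhds (2 + 1 / 2 * 0)) :=
      ((tendsto_inv_atTop_zero.comp h1).const_mul _).const_add _
    have h3 := Real.Wallis.tendsto_W_nhds_pi_div_two.mul h2
    have e : Real.pi / 2 * (2 + 1 / 2 * 0) = Real.pi := by ring
    rw [e] at h3
    refine h3.congr fun k => ?_
    have : (k : ℝ) + 1 / 4 ≠ 0 := by positivity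
    congr 1
    field_simp
    ring
  exact hanti.le_of_tendsto hlim n

theorem centralBinom_sq_le (n : ℕ) :
    (n.centralBinom : ℝ) ^ 2 * (Real.pi * (n + 1 / 4)) ≤ 16 ^ n := by
  have h := pi_le_W n
  rw [← W_mul_centralBinom_sq, mul_left_comm (Real.Wallis.W n)]
  refine mul_le_mul_of_nonneg_left ?_ (by positivity)
  rwa [← mul_div_assoc, le_div_iff₀ (by positivity)] at h

theorem central_binom_le (q : ℕ) (hq : 2 ≤ q) :
    (((q - 1).choose (q / 2) : ℝ)) ≤
      Real.sqrt (2 / Real.pi) * 2 ^ (q - 1) / Real.sqrt ((q : ℝ) - 1 / 2) := by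
  have hq' : (2 : ℝ) ≤ q := by exact_mod_cast hq
  have hpos : (0 : ℝ) < (q : ℝ) - 1 / 2 := by linarith
  have hpi := Real.pi_pos
  rw [le_div_iff₀ (Real.sqrt_pos.2 hpos)]
  refine le_of_sq_le_sq_aux ?_ (by positivity)
  rw [mul_pow, mul_pow, Real.sq_sqrt hpos.le, Real.sq_sqrt (by positivity), div_mul_eq_mul_div,
    le_div_iff₀ hpi]
  obtain ⟨m, rfl | rfl⟩ := Nat.even_or_odd' q
  · obtain ⟨k, rfl⟩ : ∃ k, m = k + 1 := ⟨m - 1, by omega⟩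
    have h := centralBinom_sq_le (k + 1)
    have hc : (k + 1).centralBinom = 2 * (2 * k + 1).choose (k + 1) := by
      have e : (2 * k + 1).choose k = (2 * k + 1).choose (k + 1) :=
        Nat.choose_symm_half k |>.symm
      rw [Nat.centralBinom, show 2 * (k + 1) = (2 * k + 1) + 1 by ring, Nat.choose_succ_succ, e]
      ring
    have e1 : 2 * (k + 1) - 1 = 2 * k + 1 := by omega
    have e2 : 2 * (k + 1) / 2 = k + 1 := by omega
    rw [hc] at h
    rw [e1, e2]
    have e3 : ((2 : ℝ) ^ (2 * k + 1)) ^ 2 = 4 * 16 ^ k := by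
      rw [← pow_mul, show (2 * k + 1) * 2 = 4 * k + 2 by ring, pow_add, pow_mul]; norm_num; ring
    rw [e3]
    rw [pow_succ (16 : ℝ)] at h
    push_cast at h ⊢
    have h0 : 0 ≤ ((2 * k + 1).choose (k + 1) : ℝ) ^ 2 * Real.pi := by positivity
    nlinarith
  · have h := centralBinom_sq_le m
    have e1 : 2 * m + 1 - 1 = 2 * m := by omega
    have e2 : (2 * m + 1) / 2 = m := by omega
    rw [e1, e2]
    rw [Nat.centralBinom] at h
    have e3 : ((2 : ℝ) ^ (2 * m)) ^ 2 = 16 ^ m := by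
      rw [← pow_mul, show (2 * m) * 2 = 4 * m by ring, pow_mul]; norm_num
    rw [e3]
    push_cast
    nlinarith
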